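/- Let f : {-1,+1}^m → {0,1} be an increasing function. Then the maximum of |f̂_S| over all nonempty subsets S ⊆ {1,…,m} is attained at a singleton; that is, max_{S ≠ ∅} |f̂_S| = max_{i ∈ {1,…,m}} f̂_{{i}}. -/

import Mathlib

open Finset MeasureTheory ProbabilityTheory
open scoped symmDiff

/-- The two-element set `{-1, +1}` of real numbers.  Points of the discrete cube
`{-1,+1}^m` are modelled as functions `Fin m → SignSet`. -/
noncomputable def SignSet : Finset ℝ := {-1, 1}

instance : Nonempty SignSet := ⟨⟨1, by simp [SignSet]⟩⟩

/-- The element `+1` of `{-1,+1}`. -/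
noncomputable def sOne : SignSet := ⟨1, by simp [SignSet]⟩

/-- The element `-1` of `{-1,+1}`. -/
noncomputable def sNegOne : SignSet := ⟨-1, by simp [SignSet]⟩

lemma mul_mem_SignSet {a b : ℝ} (ha : a ∈ SignSet) (hb : b ∈ SignSet) :
    a * b ∈ SignSet := by
  simp only [SignSet, Finset.mem_insert, Finset.mem_singleton] at *
  rcases ha with h | h <;> rcases hb with h' | h' <;> norm_num [h, h']

/-- Coordinatewise product `x·y = (x₁y₁, …, x_m y_m)` of two points of `{-1,+1}^m`. -/
noncomputable def pmul {m : ℕ} (x y : Fin m → SignSet) : Fin m → SignSet :=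
  fun i => ⟨(x i : ℝ) * (y i : ℝ), mul_mem_SignSet (x i).2 (y i).2⟩

/-- Expectation of `f : {-1,+1}^m → ℝ` with respect to the uniform probability
measure `P(B) = |B| / 2^m` on `{-1,+1}^m`. -/
noncomputable def expect {m : ℕ} (f : (Fin m → SignSet) → ℝ) : ℝ :=
  (∑ x : Fin m → SignSet, f x) / 2 ^ m

/-- Expectation of a function on `{-1,+1}^m × {-1,+1}^m` with respect to the uniform
probability measure `P(B) = |B| / 4^m`. -/
noncomputable def expect2 {m : ℕ} (f : (Fin m → SignSet) × (Fin m → SignSet) → ℝ) : ℝ :=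
  (∑ p : (Fin m → SignSet) × (Fin m → SignSet), f p) / 4 ^ m

/-- The uniform probability measure on `{-1,+1}^m`. -/
noncomputable def unifMeasure (m : ℕ) : Measure (Fin m → SignSet) :=
  (PMF.uniformOfFintype (Fin m → SignSet)).toMeasure

/-- The uniform probability measure on `{-1,+1}^m × {-1,+1}^m`. -/
noncomputable def unifMeasure2 (m : ℕ) : Measure ((Fin m → SignSet) × (Fin m → SignSet)) :=
  (PMF.uniformOfFintype ((Fin m → SignSet) × (Fin m → SignSet))).toMeasure

noncomputable def flipS {m : ℕ} (i : Fin m) (x : Fin m → SignSet) : Fin m → SignSet :=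
  Function.update x i ⟨-(x i : ℝ), by
    have := (x i).2
    simp only [SignSet, Finset.mem_insert, Finset.mem_singleton] at *
    rcases this with h | h <;> rw [h] <;> norm_num⟩

lemma flipS_same {m : ℕ} (i : Fin m) (x : Fin m → SignSet) :
    ((flipS i x i : SignSet) : ℝ) = -(x i : ℝ) := by
  simp [flipS]

lemma flipS_ne {m : ℕ} {i j : Fin m} (h : j ≠ i) (x : Fin m → SignSet) :
    flipS i x j = x j := by
  simp [flipS, h]

lemma flipS_invol {m : ℕ} (i : Fin m) : Function.Involutive (flipS i) := by
  intro x
  funext j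
  apply Subtype.ext
  by_cases h : j = i
  · subst h
    rw [flipS_same, flipS_same, neg_neg]
  · rw [flipS_ne h, flipS_ne h]

lemma sum_flipS {m : ℕ} (i : Fin m) (g : (Fin m → SignSet) → ℝ) :
    ∑ x, g (flipS i x) = ∑ x, g x :=
  Equiv.sum_comp (flipS_invol i).toPerm g

noncomputable def chiS {m : ℕ} (S : Finset (Fin m)) (x : Fin m → SignSet) : ℝ :=
  ∏ i ∈ S, (x i : ℝ)

lemma chiS_notMem {m : ℕ} {i : Fin m} {S : Finset (Fin m)} (h : i ∉ S) (x : Fin m → SignSet) :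
    chiS S (flipS i x) = chiS S x := by
  unfold chiS
  apply Finset.prod_congr rfl
  intro j hj
  have hji : j ≠ i := by
    rintro rfl
    exact h hj
  rw [flipS_ne hji]

lemma chiS_mem {m : ℕ} {i : Fin m} {S : Finset (Fin m)} (h : i ∈ S) (x : Fin m → SignSet) :
    chiS S (flipS i x) = - chiS S x := by
  have h1 := chiS_notMem (Finset.notMem_erase i S) x
  unfold chiS at *
  rw [← Finset.mul_prod_erase S _ h, ← Finset.mul_prod_erase S _ h, h1, flipS_same]
  ring

lemma sign_cases (a : SignSet) : (a : ℝ) = -1 ∨ (a : ℝ) = 1 := by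
  have := a.2
  simpa only [SignSet, Finset.mem_insert, Finset.mem_singleton] using this

lemma chiS_abs {m : ℕ} (S : Finset (Fin m)) (x : Fin m → SignSet) : |chiS S x| = 1 := by
  unfold chiS
  rw [Finset.abs_prod]
  apply Finset.prod_eq_one
  intro i _
  rcases sign_cases (x i) with h | h <;> rw [h] <;> norm_num

lemma chiS_orth {m : ℕ} {S T : Finset (Fin m)} (h : S ≠ T) :
    ∑ x, chiS S x * chiS T x = 0 := by
  have : ∃ i, ¬ (i ∈ S ↔ i ∈ T) := by
    by_contra! hh
    exact h (Finset.ext hh)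
  obtain ⟨i, hi⟩ := this
  have h1 := sum_flipS i (fun x => chiS S x * chiS T x)
  have h2 : ∀ x, chiS S (flipS i x) * chiS T (flipS i x) = -(chiS S x * chiS T x) := by
    intro x
    by_cases hS : i ∈ S
    · have hT : i ∉ T := fun hT => hi ⟨fun _ => hT, fun _ => hS⟩
      rw [chiS_mem hS, chiS_notMem hT]; ring
    · have hT : i ∈ T := by tauto
      rw [chiS_mem hT, chiS_notMem hS]; ring
  simp only [h2, Finset.sum_neg_distrib] at h1
  linarith

lemma coeff_inv {m : ℕ} (f : (Fin m → SignSet) → ℝ) (c : Finset (Fin m) → ℝ)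
    (hc : ∀ x, f x = ∑ S : Finset (Fin m), c S * chiS S x) (S : Finset (Fin m)) :
    ∑ x, f x * chiS S x = c S * (Fintype.card (Fin m → SignSet) : ℝ) := by
  simp only [hc, Finset.sum_mul]
  rw [Finset.sum_comm, Finset.sum_eq_single S]
  · have : ∀ x, c S * chiS S x * chiS S x = c S := by
      intro x
      have h := abs_mul_abs_self (chiS S x)
      rw [chiS_abs] at h
      rw [mul_assoc, ← h]; ring
    simp only [this, Finset.sum_const, Finset.card_univ, nsmul_eq_mul]
    ring
  · intro T _ hT
    simp only [mul_assoc]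
    rw [← Finset.mul_sum, chiS_orth hT, mul_zero]
  · simp

lemma half_sum {m : ℕ} (f : (Fin m → SignSet) → ℝ) {i : Fin m} {S : Finset (Fin m)}
    (h : i ∈ S) :
    ∑ x, (f x - f (flipS i x)) * chiS S x = 2 * ∑ x, f x * chiS S x := by
  have h1 := sum_flipS i (fun x => f x * chiS S x)
  simp only [chiS_mem h, mul_neg, Finset.sum_neg_distrib] at h1
  simp only [sub_mul, Finset.sum_sub_distrib]
  linarith

lemma key_le {m : ℕ} (f : (Fin m → SignSet) → ℝ)
    (hmono : ∀ a b : Fin m → SignSet, (∀ i, (a i : ℝ) ≤ (b i : ℝ)) → f a ≤ f b)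
    (c : Finset (Fin m) → ℝ)
    (hc : ∀ x, f x = ∑ S : Finset (Fin m), c S * chiS S x) {i : Fin m} {S : Finset (Fin m)}
    (h : i ∈ S) : |c S| ≤ c {i} := by
  have hN : (0 : ℝ) < (Fintype.card (Fin m → SignSet) : ℝ) := by
    exact_mod_cast Fintype.card_pos
  have e1 := half_sum f h
  have e2 := half_sum f (Finset.mem_singleton_self i)
  rw [coeff_inv f c hc] at e1 e2
  have hab : ∀ x, |(f x - f (flipS i x)) * chiS S x| = (f x - f (flipS i x)) * chiS {i} x := by
    intro x
    rw [abs_mul, chiS_abs, mul_one]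
    have hx : chiS {i} x = (x i : ℝ) := by simp [chiS]
    rw [hx]
    rcases sign_cases (x i) with hi | hi
    · have : f x ≤ f (flipS i x) := by
        apply hmono
        intro j
        by_cases hj : j = i
        · subst hj
          rw [flipS_same, hi]; norm_num
        · rw [flipS_ne hj]
      rw [hi, abs_of_nonpos (by linarith)]; ring
    · have : f (flipS i x) ≤ f x := by
        apply hmono
        intro j
        by_cases hj : j = i
        · subst hj
          rw [flipS_same, hi]; norm_num
        · rw [flipS_ne hj]
      rw [hi, abs_of_nonneg (by linarith)]; ring
  have h3 := Finset.abs_sum_le_sum_abs (fun x => (f x - f (flipS i x)) * chiS S x) Finset.univ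
  simp only [hab] at h3
  rw [e1, e2, abs_mul, abs_mul, abs_of_pos hN, abs_of_pos (by norm_num : (0 : ℝ) < 2)] at h3
  have h4 : |c S| * (Fintype.card (Fin m → SignSet) : ℝ) ≤
      c {i} * (Fintype.card (Fin m → SignSet) : ℝ) := by linarith
  exact le_of_mul_le_mul_right h4 hN

/-- For an increasing `f : {-1,+1}^m → {0,1}`,
`max_{S ≠ ∅} |f̂_S| = max_{i} f̂_{{i}}`. -/
theorem statement10 (m : ℕ) (hm : 0 < m) (f : (Fin m → SignSet) → ℝ)
    (hf01 : ∀ x, f x = 0 ∨ f x = 1)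
    (hmono : ∀ a b : Fin m → SignSet, (∀ i, (a i : ℝ) ≤ (b i : ℝ)) → f a ≤ f b)
    (c : Finset (Fin m) → ℝ)
    (hc : ∀ x : Fin m → SignSet, f x = ∑ S : Finset (Fin m), c S * ∏ i ∈ S, (x i : ℝ)) :
    (Finset.univ.filter (fun S : Finset (Fin m) => S ≠ ∅)).sup'
        ⟨{⟨0, hm⟩}, by simp⟩ (fun S => |c S|) =
      Finset.univ.sup' ⟨⟨0, hm⟩, Finset.mem_univ _⟩ (fun i : Fin m => c {i}) := by
  apply le_antisymm
  · apply Finset.sup'_le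
    intro S hS
    obtain ⟨i, hi⟩ := Finset.nonempty_iff_ne_empty.mpr (Finset.mem_filter.mp hS).2
    exact (key_le f hmono c hc hi).trans
      (Finset.le_sup' (fun i : Fin m => c {i}) (Finset.mem_univ i))
  · apply Finset.sup'_le
    intro i _
    exact (le_abs_self _).trans
      (Finset.le_sup' (fun S : Finset (Fin m) => |c S|) (by simp))
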